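/- Consider the differential module M over ℂ((t)) with basis f₁, f₂ and derivation δ (relative to t·d/dt) given by δf₁ = h f₂, δf₂ = t h f₁ + (1/2) f₂, where h ∈ t^{−1}ℂ[t^{−1}] is a nonzero Laurent polynomial (with t h having a pole). Then every lattice Λ ⊂ M invariant in the sense that t^{r⁺} δΛ ⊂ Λ is of the form tⁿ·(ℂ[[t]]f₁ + ℂ[[t]]f₂) or tⁿ·(ℂ[[t]]tf₁ + ℂ[[t]]f₂) for some n ∈ ℤ. -/

import Mathlib

namespace Stmt11

/-- The field `K = ℂ((t))` of formal Laurent series. -/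
noncomputable abbrev K := LaurentSeries ℂ

/-- The derivation `t·d/dt` on `ℂ((t))`: it multiplies the coefficient of `tⁿ` by `n`. -/
noncomputable def tdt (f : K) : K where
  coeff n := (n : ℂ) * f.coeff n
  isPWO_support' := f.isPWO_support'.mono (by
    intro n hn
    simp only [Function.mem_support, ne_eq] at hn ⊢
    intro h
    exact hn (by rw [h, mul_zero]))

/-- The element `t ∈ ℂ((t))`. -/
noncomputable def tt : K := HahnSeries.single (1 : ℤ) (1 : ℂ)

/-- `tⁿ` for `n ∈ ℤ`. -/
noncomputable def tpow (n : ℤ) : K := HahnSeries.single n (1 : ℂ)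

/-- The differential module `M = K f₁ ⊕ K f₂` with `δf₁ = h f₂`,
`δf₂ = t h f₁ + ½ f₂`, written on coordinates: an element `(a,b)` stands for
`a f₁ + b f₂` and `δ(a,b) = (t·a′ + t h b, h a + t·b′ + b/2)`. -/
noncomputable def δ (h : K) (m : K × K) : K × K :=
  (tdt m.1 + tt * h * m.2, h * m.1 + tdt m.2 + (2 : K)⁻¹ * m.2)

/-- `Λ` is a lattice: a free `ℂ[[t]]`-submodule of rank two containing a `K`-basis. -/
def IsLattice (Λ : Submodule (PowerSeries ℂ) (K × K)) : Prop :=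
  ∃ v w : K × K, Λ = Submodule.span (PowerSeries ℂ) {v, w} ∧
    LinearIndependent K ![v, w]

/-- `x` has no terms of degree below `n`. -/
def Van (n : ℤ) (x : K) : Prop := ∀ k < n, x.coeff k = 0

lemma smul_eq (p : PowerSeries ℂ) (x : K) : p • x = (p : K) * x := rfl

lemma coeff_smul_tpow (p : PowerSeries ℂ) (n k : ℤ) :
    (p • tpow n).coeff k = (p : K).coeff (k - n) := by
  rw [smul_eq, tpow]
  have := HahnSeries.coeff_mul_single_add (r := (1:ℂ)) (x := (p : K)) (a := k - n) (b := n)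
  simpa using this

lemma van_smul (p : PowerSeries ℂ) (n : ℤ) : Van n (p • tpow n) := by
  intro k hk
  rw [coeff_smul_tpow, PowerSeries.coeff_coe, if_pos (by omega)]

lemma coeff_smul_self (p : PowerSeries ℂ) (n : ℤ) :
    (p • tpow n).coeff n = PowerSeries.constantCoeff p := by
  rw [coeff_smul_tpow, PowerSeries.coeff_coe]
  simp

lemma van_iff {n : ℤ} {x : K} (hx : Van n x) : ∃ p : PowerSeries ℂ, x = p • tpow n := by
  refine ⟨PowerSeries.mk fun k => x.coeff (n + k), ?_⟩
  ext k
  rw [coeff_smul_tpow, PowerSeries.coeff_coe]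
  split_ifs with hk
  · exact hx k (by omega)
  · rw [PowerSeries.coeff_mk]
    congr 1
    omega

lemma tpow_mul (m n : ℤ) : tpow m * tpow n = tpow (m + n) := by
  simp [tpow]

lemma Van.mul {m n : ℤ} {x y : K} (hx : Van m x) (hy : Van n y) : Van (m + n) (x * y) := by
  obtain ⟨p, rfl⟩ := van_iff hx
  obtain ⟨q, rfl⟩ := van_iff hy
  have : p • tpow m * q • tpow n = (p * q) • tpow (m + n) := by
    rw [smul_mul_smul_comm, tpow_mul]
  rw [this]
  exact van_smul _ _

lemma Van.add {n : ℤ} {x y : K} (hx : Van n x) (hy : Van n y) : Van n (x + y) := by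
  intro k hk
  simp [hx k hk, hy k hk]

lemma Van.mono {m n : ℤ} {x : K} (hx : Van n x) (h : m ≤ n) : Van m x :=
  fun k hk => hx k (by omega)

lemma Van.tdt {n : ℤ} {x : K} (hx : Van n x) : Van n (tdt x) := by
  intro k hk
  simp [Stmt11.tdt, hx k hk]

lemma van_half : Van 0 ((2 : K)⁻¹) := by
  have : (2 : K)⁻¹ = HahnSeries.C (2⁻¹ : ℂ) := by
    rw [map_inv₀, map_ofNat]
  rw [this]
  intro k hk
  simp [HahnSeries.C_apply, HahnSeries.coeff_single_of_ne hk.ne]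

lemma van_inv {h : K} (hne : h ≠ 0) (hpole : ∃ n : ℤ, n < -1 ∧ h.coeff n ≠ 0) :
    Van 2 h⁻¹ := by
  obtain ⟨n, hn, hc⟩ := hpole
  have h1 := HahnSeries.order_le_of_coeff_ne_zero hc
  have h2 := HahnSeries.order_mul hne (inv_ne_zero hne)
  rw [mul_inv_cancel₀ hne, HahnSeries.order_one] at h2
  intro k hk
  exact HahnSeries.coeff_eq_zero_of_lt_order (by omega)

lemma exists_van (x : K) : ∃ n, Van n x :=
  ⟨x.order, fun _ hk => HahnSeries.coeff_eq_zero_of_lt_order hk⟩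

lemma main_span (i j : ℤ) (Λ : Submodule (PowerSeries ℂ) (K × K))
    (hΛ : ∀ m ∈ Λ, Van i m.1 ∧ Van j m.2) (v w : K × K) (hv : v ∈ Λ) (hw : w ∈ Λ)
    (hdet : v.1.coeff i * w.2.coeff j - v.2.coeff j * w.1.coeff i ≠ 0) :
    Λ = Submodule.span (PowerSeries ℂ) {((tpow i, 0) : K × K), ((0, tpow j) : K × K)} := by
  apply le_antisymm
  · rintro ⟨x, y⟩ hm
    obtain ⟨hx, hy⟩ := hΛ _ hm
    obtain ⟨p, hp⟩ := van_iff hx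
    obtain ⟨q, hq⟩ := van_iff hy
    rw [Submodule.mem_span_pair]
    refine ⟨p, q, ?_⟩
    simp only at hp hq
    simp [hp, hq]
  · obtain ⟨v1, v2⟩ := v
    obtain ⟨w1, w2⟩ := w
    obtain ⟨h1, h2⟩ := hΛ _ hv
    obtain ⟨h3, h4⟩ := hΛ _ hw
    obtain ⟨A, hA⟩ := van_iff h1
    obtain ⟨B, hB⟩ := van_iff h2
    obtain ⟨C, hC⟩ := van_iff h3
    obtain ⟨D, hD⟩ := van_iff h4
    simp only at hA hB hC hD
    subst hA hB hC hD
    simp only [coeff_smul_self] at hdet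
    have hd : PowerSeries.constantCoeff (A * D - B * C) ≠ 0 := by
      simpa using hdet
    have hinv := PowerSeries.inv_mul_cancel _ hd
    set d := (A * D - B * C)⁻¹
    rw [Submodule.span_le]
    rintro m (rfl | rfl)
    · have : ((tpow i, 0) : K × K) = (d * D) • (A • tpow i, B • tpow j)
          - (d * B) • (C • tpow i, D • tpow j) := by
        ext1
        · simp only [Prod.fst_sub, Prod.smul_fst, smul_smul, ← sub_smul]
          rw [show d * D * A - d * B * C = d * (A * D - B * C) by ring, hinv, one_smul]
        · simp only [Prod.snd_sub, Prod.smul_snd, smul_smul, ← sub_smul]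
          rw [show d * D * B - d * B * D = 0 by ring]
          rw [smul_eq]; simp
      rw [this]
      exact Λ.sub_mem (Λ.smul_mem _ hv) (Λ.smul_mem _ hw)
    · have : ((0, tpow j) : K × K) = (d * A) • (C • tpow i, D • tpow j)
          - (d * C) • (A • tpow i, B • tpow j) := by
        ext1
        · simp only [Prod.fst_sub, Prod.smul_fst, smul_smul, ← sub_smul]
          rw [show d * A * C - d * C * A = 0 by ring]
          rw [smul_eq]; simp
        · simp only [Prod.snd_sub, Prod.smul_snd, smul_smul, ← sub_smul]
          rw [show d * A * D - d * C * B = d * (A * D - B * C) by ring, hinv, one_smul]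
      rw [this]
      exact Λ.sub_mem (Λ.smul_mem _ hw) (Λ.smul_mem _ hv)

lemma lattice_bdd (v w : K × K) : ∃ N, ∀ m ∈ Submodule.span (PowerSeries ℂ) {v, w},
    Van N m.1 ∧ Van N m.2 := by
  obtain ⟨a, ha⟩ := exists_van v.1
  obtain ⟨b, hb⟩ := exists_van v.2
  obtain ⟨c, hc⟩ := exists_van w.1
  obtain ⟨d, hd⟩ := exists_van w.2
  have key : ∀ (N : ℤ) (p q : PowerSeries ℂ) (x y : K), Van N x → Van N y →
      Van N (p • x + q • y) := by
    intro N p q x y hx hy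
    obtain ⟨r, rfl⟩ := van_iff hx
    obtain ⟨s, rfl⟩ := van_iff hy
    rw [smul_smul, smul_smul, ← add_smul]
    exact van_smul _ _
  refine ⟨min (min a b) (min c d), fun m hm => ?_⟩
  obtain ⟨p, q, rfl⟩ := Submodule.mem_span_pair.1 hm
  exact ⟨key _ _ _ _ _ (ha.mono (by omega)) (hc.mono (by omega)),
    key _ _ _ _ _ (hb.mono (by omega)) (hd.mono (by omega))⟩

lemma coeff_tt_mul (x : K) (n : ℤ) : (tt * x).coeff (n + 1) = x.coeff n := by
  have := HahnSeries.coeff_single_mul_add (r := (1:ℂ)) (x := x) (a := n) (b := 1)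
  simpa [tt] using this

/-- Every invariant lattice of the ramified differential module
`δf₁ = h f₂, δf₂ = t h f₁ + ½ f₂` (with `h ∈ t⁻¹ℂ[t⁻¹]` nonzero and `t·h` having a
pole) is of the form `tⁿ·(ℂ[[t]]f₁ + ℂ[[t]]f₂)` or `tⁿ·(ℂ[[t]]tf₁ + ℂ[[t]]f₂)`.
Invariance is expressed, as in the text, by `ΔΛ ⊆ Λ` for `Δ = h⁻¹δ`. -/
theorem stmt_11 (h : K) (hne : h ≠ 0)
    (hpolypart : ∀ n : ℤ, 0 ≤ n → h.coeff n = 0)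
    (hpole : ∃ n : ℤ, n < -1 ∧ h.coeff n ≠ 0)
    (Λ : Submodule (PowerSeries ℂ) (K × K))
    (hlat : IsLattice Λ)
    (hinv : ∀ m ∈ Λ, h⁻¹ • δ h m ∈ Λ) :
    ∃ n : ℤ,
      Λ = Submodule.span (PowerSeries ℂ) {((tpow n, 0) : K × K), ((0, tpow n) : K × K)} ∨
      Λ = Submodule.span (PowerSeries ℂ)
        {((tpow (n + 1), 0) : K × K), ((0, tpow n) : K × K)} := by
  have hi := van_inv hne hpole
  have hΔ : ∀ m : K × K, h⁻¹ • δ h m = (tt * m.2 + h⁻¹ * tdt m.1,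
      m.1 + h⁻¹ * (tdt m.2 + (2 : K)⁻¹ * m.2)) := by
    intro m
    ext1
    · simp only [δ, Prod.smul_fst, smul_eq_mul]
      field_simp
      ring
    · simp only [δ, Prod.smul_snd, smul_eq_mul]
      generalize (2 : K)⁻¹ = c
      field_simp
      ring
  have hE1 : ∀ n (x : K), Van n x → Van (n + 2) (h⁻¹ * tdt x) := fun n x hx =>
    (hi.mul hx.tdt).mono (by omega)
  have hE2 : ∀ n (x : K), Van n x → Van (n + 2) (h⁻¹ * (tdt x + (2 : K)⁻¹ * x)) :=
    fun n x hx => (hi.mul (hx.tdt.add ((van_half.mul hx).mono (by omega)))).mono (by omega)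
  obtain ⟨v, w, hspan, hli⟩ := hlat
  have hv0 : v ≠ 0 := hli.ne_zero 0
  obtain ⟨N, hN⟩ := lattice_bdd v w
  rw [← hspan] at hN
  have hvΛ : v ∈ Λ := hspan ▸ Submodule.subset_span (by simp)
  have hne' : ∃ k : ℤ, ∃ m ∈ Λ, m.1.coeff k ≠ 0 ∨ m.2.coeff k ≠ 0 := by
    by_contra hcon
    push Not at hcon
    apply hv0
    ext k
    · exact (hcon k v hvΛ).1
    · exact (hcon k v hvΛ).2
  obtain ⟨n, ⟨m, hm, hmn⟩, hmin⟩ := Int.exists_least_of_bdd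
    (P := fun k : ℤ => ∃ m ∈ Λ, m.1.coeff k ≠ 0 ∨ m.2.coeff k ≠ 0)
    ⟨N, by
      rintro k ⟨m, hm, hk⟩
      by_contra hlt
      push Not at hlt
      rcases hk with hk | hk
      · exact hk ((hN m hm).1 k hlt)
      · exact hk ((hN m hm).2 k hlt)⟩ hne'
  have hVan : ∀ m ∈ Λ, Van n m.1 ∧ Van n m.2 := by
    intro m hm
    constructor
    · intro k hk
      by_contra hc
      exact absurd (hmin k ⟨m, hm, Or.inl hc⟩) (by omega)
    · intro k hk
      by_contra hc
      exact absurd (hmin k ⟨m, hm, Or.inr hc⟩) (by omega)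
  refine ⟨n, ?_⟩
  by_cases hA : ∃ m ∈ Λ, m.1.coeff n ≠ 0
  · left
    obtain ⟨m, hm, hmn⟩ := hA
    obtain ⟨h1, h2⟩ := hVan m hm
    refine main_span n n Λ hVan m _ hm (hinv m hm) ?_
    rw [hΔ]
    have e1 : (tt * m.2).coeff n = 0 := by
      have := coeff_tt_mul m.2 (n - 1)
      rw [sub_add_cancel] at this
      rw [this]
      exact h2 _ (by omega)
    simp only [HahnSeries.coeff_add, e1, hE1 n _ h1 n (by omega), hE2 n _ h2 n (by omega)]
    simpa using hmn
  · right
    push Not at hA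
    have hVan' : ∀ m ∈ Λ, Van (n + 1) m.1 ∧ Van n m.2 := by
      intro m hm
      refine ⟨fun k hk => ?_, (hVan m hm).2⟩
      rcases (show k < n ∨ k = n by omega) with hk | rfl
      · exact (hVan m hm).1 k hk
      · exact hA m hm
    obtain ⟨h1, h2⟩ := hVan' m hm
    have hb : m.2.coeff n ≠ 0 := hmn.resolve_left (by simp [hA m hm])
    refine main_span (n + 1) n Λ hVan' m _ hm (hinv m hm) ?_
    rw [hΔ]
    simp only [HahnSeries.coeff_add, coeff_tt_mul, hE1 _ _ h1 (n + 1) (by omega),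
      hE2 n _ h2 n (by omega), hA m hm]
    simpa using hb

end Stmt11
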